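/- Let C be a semidualizing module over a commutative noetherian ring R. An R-module V belongs to F_C if and only if V belongs to the Bass class B_C and the R-module Hom_R(C,V) is flat. -/

import Mathlib

/-!
Common definitions: Ext/Tor vanishing, semidualizing modules, the Auslander and Bass
classes, (pre)covers and (pre)envelopes, cotorsion pairs, the classes `I_C` and `F_C`,
purity, and Kaplansky classes.
-/

open CategoryTheory

universe u

noncomputable section

/-- `Ext^j_R(A,B) = 0`. -/
def extVanishes (R : Type u) [CommRing R] (A B : ModuleCat.{u} R) (j : ℕ) : Prop :=
  Subsingleton (((Ext R (ModuleCat.{u} R) j).obj (Opposite.op A)).obj B)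

/-- `Tor_j^R(A,B) = 0`. -/
def torVanishes (R : Type u) [CommRing R] (A B : ModuleCat.{u} R) (j : ℕ) : Prop :=
  Subsingleton (((Tor (ModuleCat.{u} R) j).obj A).obj B)

/-- A semidualizing module: finitely generated, `Ext^j(C,C) = 0` for all `j > 0`, and the
homothety map `χ_C : R → Hom_R(C,C)`, `r ↦ r • id`, is an isomorphism (bijective). -/
def IsSemidualizing (R : Type u) [CommRing R] (C : Type u) [AddCommGroup C] [Module R C] :
    Prop :=
  Module.Finite R C ∧
  (∀ j : ℕ, 0 < j → extVanishes R (ModuleCat.of R C) (ModuleCat.of R C) j) ∧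
  Function.Bijective (fun r : R => r • (LinearMap.id : C →ₗ[R] C))

/-- The natural map `η_M : M → Hom_R(C, C ⊗_R M)`, `m ↦ (c ↦ c ⊗ m)`. -/
def etaMap (R : Type u) [CommRing R] (C : Type u) [AddCommGroup C] [Module R C]
    (M : Type u) [AddCommGroup M] [Module R M] :
    M →ₗ[R] (C →ₗ[R] TensorProduct R C M) :=
  (TensorProduct.mk R C M).flip

/-- The evaluation map `ε_N : C ⊗_R Hom_R(C,N) → N`, `c ⊗ f ↦ f c`. -/
def epsMap (R : Type u) [CommRing R] (C : Type u) [AddCommGroup C] [Module R C]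
    (N : Type u) [AddCommGroup N] [Module R N] :
    TensorProduct R C (C →ₗ[R] N) →ₗ[R] N :=
  TensorProduct.lift (LinearMap.id (R := R) (M := C →ₗ[R] N)).flip

/-- Membership in the Auslander class `A_C`. -/
def memAuslander (R : Type u) [CommRing R] (C : Type u) [AddCommGroup C] [Module R C]
    (M : ModuleCat.{u} R) : Prop :=
  (∀ j : ℕ, 0 < j → torVanishes R (ModuleCat.of R C) M j) ∧
  (∀ j : ℕ, 0 < j →
    extVanishes R (ModuleCat.of R C) (ModuleCat.of R (TensorProduct R C M)) j) ∧
  Function.Bijective (etaMap R C M)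

/-- Membership in the Bass class `B_C`. -/
def memBass (R : Type u) [CommRing R] (C : Type u) [AddCommGroup C] [Module R C]
    (N : ModuleCat.{u} R) : Prop :=
  (∀ j : ℕ, 0 < j → extVanishes R (ModuleCat.of R C) N j) ∧
  (∀ j : ℕ, 0 < j →
    torVanishes R (ModuleCat.of R C) (ModuleCat.of R (C →ₗ[R] N)) j) ∧
  Function.Bijective (epsMap R C N)

/-- The Auslander class `A_C` as a class of modules. -/
def auslanderClass (R : Type u) [CommRing R] (C : Type u) [AddCommGroup C] [Module R C] :
    Set (ModuleCat.{u} R) :=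
  {M | memAuslander R C M}

/-- The Bass class `B_C` as a class of modules. -/
def bassClass (R : Type u) [CommRing R] (C : Type u) [AddCommGroup C] [Module R C] :
    Set (ModuleCat.{u} R) :=
  {N | memBass R C N}

variable (R : Type u) [CommRing R]

/-- `φ : F → M` is an `𝓕`-precover of `M`. -/
def IsPrecover (𝓕 : Set (ModuleCat.{u} R)) {F M : ModuleCat.{u} R} (φ : F ⟶ M) : Prop :=
  F ∈ 𝓕 ∧ ∀ F' ∈ 𝓕, ∀ φ' : F' ⟶ M, ∃ ψ : F' ⟶ F, ψ ≫ φ = φ'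

/-- `φ : F → M` is an `𝓕`-cover of `M`. -/
def IsCover (𝓕 : Set (ModuleCat.{u} R)) {F M : ModuleCat.{u} R} (φ : F ⟶ M) : Prop :=
  IsPrecover R 𝓕 φ ∧ ∀ f : F ⟶ F, f ≫ φ = φ → IsIso f

/-- `φ : M → F` is an `𝓕`-preenvelope of `M`. -/
def IsPreenvelope (𝓕 : Set (ModuleCat.{u} R)) {M F : ModuleCat.{u} R} (φ : M ⟶ F) : Prop :=
  F ∈ 𝓕 ∧ ∀ F' ∈ 𝓕, ∀ φ' : M ⟶ F', ∃ ψ : F ⟶ F', φ ≫ ψ = φ'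

/-- `φ : M → F` is an `𝓕`-envelope of `M`. -/
def IsEnvelope (𝓕 : Set (ModuleCat.{u} R)) {M F : ModuleCat.{u} R} (φ : M ⟶ F) : Prop :=
  IsPreenvelope R 𝓕 φ ∧ ∀ f : F ⟶ F, φ ≫ f = φ → IsIso f

/-- The class `𝓕` is precovering. -/
def Precovering (𝓕 : Set (ModuleCat.{u} R)) : Prop :=
  ∀ M : ModuleCat.{u} R, ∃ (F : ModuleCat.{u} R) (φ : F ⟶ M), IsPrecover R 𝓕 φ

/-- The class `𝓕` is covering. -/
def Covering (𝓕 : Set (ModuleCat.{u} R)) : Prop :=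
  ∀ M : ModuleCat.{u} R, ∃ (F : ModuleCat.{u} R) (φ : F ⟶ M), IsCover R 𝓕 φ

/-- The class `𝓕` is preenveloping. -/
def Preenveloping (𝓕 : Set (ModuleCat.{u} R)) : Prop :=
  ∀ M : ModuleCat.{u} R, ∃ (F : ModuleCat.{u} R) (φ : M ⟶ F), IsPreenvelope R 𝓕 φ

/-- The class `𝓕` is enveloping. -/
def Enveloping (𝓕 : Set (ModuleCat.{u} R)) : Prop :=
  ∀ M : ModuleCat.{u} R, ∃ (F : ModuleCat.{u} R) (φ : M ⟶ F), IsEnvelope R 𝓕 φ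

/-- `𝓕^⊥ = {N | Ext^1(F,N) = 0 for all F ∈ 𝓕}`. -/
def rightPerp (𝓕 : Set (ModuleCat.{u} R)) : Set (ModuleCat.{u} R) :=
  {N | ∀ F ∈ 𝓕, extVanishes R F N 1}

/-- `^⊥𝓖 = {M | Ext^1(M,G) = 0 for all G ∈ 𝓖}`. -/
def leftPerp (𝓖 : Set (ModuleCat.{u} R)) : Set (ModuleCat.{u} R) :=
  {M | ∀ G ∈ 𝓖, extVanishes R M G 1}

/-- `(𝓕, 𝓖)` is a cotorsion pair. -/
def IsCotorsionPair (𝓕 𝓖 : Set (ModuleCat.{u} R)) : Prop :=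
  rightPerp R 𝓕 = 𝓖 ∧ leftPerp R 𝓖 = 𝓕

/-- `(𝓕, 𝓖)` is a perfect cotorsion pair: a cotorsion pair with `𝓕` covering and
`𝓖` enveloping. -/
def IsPerfectCotorsionPair (𝓕 𝓖 : Set (ModuleCat.{u} R)) : Prop :=
  IsCotorsionPair R 𝓕 𝓖 ∧ Covering R 𝓕 ∧ Enveloping R 𝓖

variable (C : Type u) [AddCommGroup C] [Module R C]

/-- The class `I_C` of modules isomorphic to `Hom_R(C, I)` for an injective module `I`. -/
def memIC (V : ModuleCat.{u} R) : Prop :=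
  ∃ I : ModuleCat.{u} R, Module.Injective R I ∧ Nonempty (V ≃ₗ[R] (C →ₗ[R] I))

/-- The class `F_C` of modules isomorphic to `C ⊗_R F` for a flat module `F`. -/
def memFC (V : ModuleCat.{u} R) : Prop :=
  ∃ F : ModuleCat.{u} R, Module.Flat R F ∧ Nonempty (V ≃ₗ[R] TensorProduct R C F)

/-- A short exact sequence `0 → A → B → D → 0` (given by `f` and `g`) is pure exact:
it is exact and remains exact after applying `P ⊗_R −` for every `R`-module `P`. -/
def IsPureExactSeq {A B D : Type u} [AddCommGroup A] [Module R A] [AddCommGroup B]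
    [Module R B] [AddCommGroup D] [Module R D] (f : A →ₗ[R] B) (g : B →ₗ[R] D) : Prop :=
  Function.Injective f ∧ Function.Exact f g ∧ Function.Surjective g ∧
  ∀ (P : Type u) [AddCommGroup P] [Module R P],
    Function.Injective (LinearMap.lTensor P f) ∧
    Function.Exact (LinearMap.lTensor P f) (LinearMap.lTensor P g) ∧
    Function.Surjective (LinearMap.lTensor P g)

/-- A submodule is pure if tensoring the inclusion with any module keeps it injective. -/
def IsPureSubmodule {E : Type u} [AddCommGroup E] [Module R E] (A : Submodule R E) : Prop :=
  ∀ (P : Type u) [AddCommGroup P] [Module R P],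
    Function.Injective (LinearMap.lTensor P A.subtype)

/-- `𝓕` is a Kaplansky class. -/
def KaplanskyClass (𝓕 : Set (ModuleCat.{u} R)) : Prop :=
  ∃ lam : Cardinal.{u}, ∀ M ∈ 𝓕, ∀ x : M, ∃ M' : Submodule R M,
    x ∈ M' ∧ Cardinal.mk M' ≤ lam ∧
    ModuleCat.of R M' ∈ 𝓕 ∧ ModuleCat.of R (M ⧸ M') ∈ 𝓕

end

section FiniteResolution

variable {R : Type u} [CommRing R] [IsNoetherianRing R]

theorem FGModuleCat.projective_of_module_projective (P : FGModuleCat.{u} R)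
    [Module.Projective R P] : Projective P where
  factors {E X} f e _ := by
    have : Epi ((forget₂ (FGModuleCat R) (ModuleCat.{u} R)).map e) := inferInstance
    have he : Function.Surjective e.hom.hom := (ModuleCat.epi_iff_surjective _).1 this
    obtain ⟨g, hg⟩ := Module.projective_lifting_property e.hom.hom f.hom.hom he
    refine ⟨⟨ModuleCat.ofHom g⟩, ?_⟩
    ext x
    exact LinearMap.congr_fun hg x

theorem FGModuleCat.exists_epi_free (M : FGModuleCat.{u} R) :
    ∃ (n : ℕ) (f : FGModuleCat.of R (Fin n → R) ⟶ M), Epi f := by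
  obtain ⟨n, f, hf⟩ := Module.Finite.exists_fin' R M
  refine ⟨n, ⟨ModuleCat.ofHom f⟩, ?_⟩
  exact (forget₂ (FGModuleCat R) (ModuleCat.{u} R)).epi_of_epi_map
    ((ModuleCat.epi_iff_surjective _).2 hf)

instance : EnoughProjectives (FGModuleCat.{u} R) where
  presentation M := by
    obtain ⟨n, f, hf⟩ := FGModuleCat.exists_epi_free M
    have : Module.Projective R (FGModuleCat.of R (Fin n → R)) :=
      inferInstanceAs (Module.Projective R (Fin n → R))
    exact ⟨{ p := _, projective := FGModuleCat.projective_of_module_projective _, f := f }⟩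

instance : (forget₂ (FGModuleCat.{u} R) (ModuleCat.{u} R)).PreservesProjectiveObjects where
  projective_obj {P} _ := by
    obtain ⟨n, f, hf⟩ := FGModuleCat.exists_epi_free P
    have : Projective (ModuleCat.of R (Fin n → R)) := inferInstance
    exact Retract.projective (Y := ModuleCat.of R (Fin n → R))
      ((Retract.mk (Projective.factorThru (𝟙 P) f) f (Projective.factorThru_comp _ _)).map
        (forget₂ (FGModuleCat.{u} R) (ModuleCat.{u} R)))

theorem exists_projectiveResolution_finite (M : Type u) [AddCommGroup M] [Module R M]
    [Module.Finite R M] :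
    ∃ P : ProjectiveResolution (ModuleCat.of R M), ∀ n, Module.Finite R (P.complex.X n) :=
  ⟨(forget₂ (FGModuleCat.{u} R) (ModuleCat.{u} R)).mapProjectiveResolution
      (ProjectiveResolution.of (FGModuleCat.of R M)),
    fun n => inferInstanceAs
      (Module.Finite R ((ProjectiveResolution.of (FGModuleCat.of R M)).complex.X n))⟩

end FiniteResolution

section Flat

variable {R : Type*} [CommRing R] {A B D E : Type*} [AddCommGroup A] [Module R A]
  [AddCommGroup B] [Module R B] [AddCommGroup D] [Module R D] [AddCommGroup E] [Module R E]

theorem Module.Flat.ker_of_surjective [Module.Flat R B] [Module.Flat R D] (f : B →ₗ[R] D)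
    (hf : Function.Surjective f) : Module.Flat R (LinearMap.ker f) := by
  refine Module.Flat.iff_rTensor_preserves_injective_linearMap.2 fun N N' _ _ _ _ g hg => ?_
  have h : Function.Injective
      ((LinearMap.ker f).subtype.lTensor N' ∘ₗ g.rTensor (LinearMap.ker f)) := by
    rw [LinearMap.lTensor_comp_rTensor, ← LinearMap.rTensor_comp_lTensor]
    exact (Module.Flat.rTensor_preserves_injective_linearMap g hg).comp
      (LinearMap.lTensor_injective_of_exact_of_flat f hf _ (LinearMap.ker f).subtype_injective
        (LinearMap.exact_subtype_ker_map f) N)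
  exact Function.Injective.of_comp h

theorem lTensor_exact_of_exact_of_flat [Module.Flat R E] (C : Type*) [AddCommGroup C] [Module R C]
    {f : A →ₗ[R] B} {g : B →ₗ[R] D} {h : D →ₗ[R] E} (hfg : Function.Exact f g)
    (hgh : Function.Exact g h) (hh : Function.Surjective h) :
    Function.Exact (f.lTensor C) (g.lTensor C) := by
  have hrange : Function.Exact (LinearMap.range g).subtype h := by
    rw [LinearMap.exact_iff, Submodule.range_subtype, hgh.linearMap_ker_eq]
  have hinj := LinearMap.lTensor_injective_of_exact_of_flat h hh _
    (LinearMap.range g).subtype_injective hrange C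
  have hex : Function.Exact f g.rangeRestrict := by
    rw [LinearMap.exact_iff, LinearMap.ker_rangeRestrict, hfg.linearMap_ker_eq]
  have := (lTensor_exact C hex g.surjective_rangeRestrict).comp_injective _ hinj (map_zero _)
  rwa [← LinearMap.coe_comp, ← LinearMap.lTensor_comp,
    show (LinearMap.range g).subtype ∘ₗ g.rangeRestrict = g from rfl] at this

end Flat

section Derived

variable {R : Type u} [CommRing R]

theorem extVanishes_succ_iff {X : ModuleCat.{u} R} (P : ProjectiveResolution X)
    (Y : ModuleCat.{u} R) (n : ℕ) :
    extVanishes R X Y (n + 1) ↔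
      Function.Exact ((P.complex.d (n + 1) n).hom.lcomp R Y)
        ((P.complex.d (n + 2) (n + 1)).hom.lcomp R Y) := by
  rw [extVanishes, ← ModuleCat.isZero_iff_subsingleton, (P.isoExt (R := R) (n + 1) Y).isZero_iff,
    ← HomologicalComplex.exactAt_iff_isZero_homology,
    HomologicalComplex.exactAt_iff' _ n (n + 1) (n + 2) (by simp) (by simp),
    ShortComplex.ShortExact.moduleCat_exact_iff_function_exact]
  refine (Function.Exact.iff_of_ladder_linearEquiv (R := R)
    (e₁ := ModuleCat.homLinearEquiv (S := R)) (e₂ := ModuleCat.homLinearEquiv (S := R))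
    (e₃ := ModuleCat.homLinearEquiv (S := R)) ?_ ?_).symm
  · rfl
  · rfl

theorem torVanishes_succ_iff {X : ModuleCat.{u} R} (P : ProjectiveResolution X)
    (C : ModuleCat.{u} R) (n : ℕ) :
    torVanishes R C X (n + 1) ↔
      Function.Exact ((P.complex.d (n + 2) (n + 1)).hom.lTensor C)
        ((P.complex.d (n + 1) n).hom.lTensor C) := by
  rw [torVanishes, ← ModuleCat.isZero_iff_subsingleton]
  dsimp only [Tor]
  rw [(P.isoLeftDerivedObj _ (n + 1)).isZero_iff]
  dsimp only [HomotopyCategory.homologyFunctor, HomologicalComplex.homologyFunctor]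
  rw [← HomologicalComplex.exactAt_iff_isZero_homology,
    HomologicalComplex.exactAt_iff' _ (n + 2) (n + 1) n (by simp) (by simp),
    ShortComplex.ShortExact.moduleCat_exact_iff_function_exact]
  rfl

/-- Higher `Tor` against a flat module vanishes. -/
theorem torVanishes_of_flat (C F : ModuleCat.{u} R) [Module.Flat R F] {j : ℕ} (hj : 0 < j) :
    torVanishes R C F j := by
  obtain ⟨n, rfl⟩ := Nat.exists_eq_succ_of_ne_zero hj.ne'
  let P := ProjectiveResolution.of F
  have hflat (n : ℕ) : Module.Flat R (P.complex.X n) :=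
    have := (IsProjective.iff_projective (P.complex.X n)).2 (P.projective n)
    inferInstance
  have hex (n : ℕ) : Function.Exact (P.complex.d (n + 2) (n + 1)).hom
      (P.complex.d (n + 1) n).hom :=
    (ShortComplex.ShortExact.moduleCat_exact_iff_function_exact _).1 (P.exact_succ n)
  let π : P.complex.X 0 →ₗ[R] F := (P.π.f 0).hom
  have hex₀ : Function.Exact (P.complex.d 1 0).hom π :=
    (ShortComplex.ShortExact.moduleCat_exact_iff_function_exact _).1 P.exact₀
  have hsurj : Function.Surjective π := (ModuleCat.epi_iff_surjective (P.π.f 0)).1 inferInstance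
  have hrange (n : ℕ) : Module.Flat R (LinearMap.range (P.complex.d (n + 1) n).hom) := by
    induction n with
    | zero =>
      rw [← hex₀.linearMap_ker_eq]
      exact Module.Flat.ker_of_surjective _ hsurj
    | succ n ih =>
      rw [← (hex n).linearMap_ker_eq, ← LinearMap.ker_rangeRestrict]
      exact Module.Flat.ker_of_surjective _ (LinearMap.surjective_rangeRestrict _)
  rw [Nat.succ_eq_add_one, torVanishes_succ_iff P]
  cases n with
  | zero => exact lTensor_exact_of_exact_of_flat C (hex 0) hex₀ hsurj
  | succ n =>
    have := hrange n
    refine lTensor_exact_of_exact_of_flat C (hex (n + 1))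
      (h := (P.complex.d (n + 1) n).hom.rangeRestrict) ?_ (LinearMap.surjective_rangeRestrict _)
    rw [LinearMap.exact_iff, LinearMap.ker_rangeRestrict, (hex n).linearMap_ker_eq]

end Derived

section HomTensor

open TensorProduct

variable {R : Type*} [CommRing R] {A B D N F : Type*} [AddCommGroup A] [Module R A]
  [AddCommGroup B] [Module R B] [AddCommGroup D] [Module R D] [AddCommGroup N] [Module R N]
  [AddCommGroup F] [Module R F]

theorem rTensorHomToHomRTensor_comp_rTensor_lcomp (f : A →ₗ[R] B) :
    rTensorHomToHomRTensor (.id R) A N F ∘ₗ (f.lcomp R N).rTensor F =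
      f.lcomp R (N ⊗[R] F) ∘ₗ rTensorHomToHomRTensor (.id R) B N F := by
  ext
  simp

/-- For a finitely presented module `D` and a flat module `F`, the natural map
`Hom(D, N) ⊗ F → Hom(D, N ⊗ F)` is bijective. -/
theorem rTensorHomToHomRTensor_bijective [Module.FinitePresentation R D] [Module.Flat R F] :
    Function.Bijective (rTensorHomToHomRTensor (.id R) D N F) := by
  obtain ⟨n, m, f, g, hf, hgf⟩ := Module.FinitePresentation.exists_fin' R D
  have hbij (k : ℕ) : Function.Bijective (rTensorHomToHomRTensor (.id R) (Fin k → R) N F) := by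
    rw [← rTensorHomEquivHomRTensor_toLinearMap]
    exact (rTensorHomEquivHomRTensor R (Fin k → R) N F).bijective
  exact LinearMap.bijective_of_bijective_of_injective_of_left_exact
    ((f.lcomp R N).rTensor F) ((g.lcomp R N).rTensor F)
    (f.lcomp R (N ⊗[R] F)) (g.lcomp R (N ⊗[R] F)) _ _ _
    (rTensorHomToHomRTensor_comp_rTensor_lcomp f).symm
    (rTensorHomToHomRTensor_comp_rTensor_lcomp g).symm
    (Module.Flat.rTensor_exact F (LinearMap.exact_lcomp_of_exact_of_surjective N hgf hf))
    (LinearMap.exact_lcomp_of_exact_of_surjective _ hgf hf) (hbij n) (hbij m).1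
    (Module.Flat.rTensor_preserves_injective_linearMap _
      (LinearMap.lcomp_injective_of_surjective f hf))
    (LinearMap.lcomp_injective_of_surjective f hf)

theorem exact_lcomp_tensor [Module.Finite R A] [Module.Projective R A] [Module.Finite R B]
    [Module.Projective R B] [Module.Finite R D] [Module.Projective R D] [Module.Flat R F]
    {f : A →ₗ[R] B} {g : B →ₗ[R] D} (h : Function.Exact (g.lcomp R N) (f.lcomp R N)) :
    Function.Exact (g.lcomp R (N ⊗[R] F)) (f.lcomp R (N ⊗[R] F)) := by
  refine (Module.Flat.rTensor_exact F h).of_ladder_linearEquiv_of_exact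
    (e₁ := rTensorHomEquivHomRTensor R D N F) (e₂ := rTensorHomEquivHomRTensor R B N F)
    (e₃ := rTensorHomEquivHomRTensor R A N F) ?_ ?_
  all_goals simp [rTensorHomToHomRTensor_comp_rTensor_lcomp]

end HomTensor

section Semidualizing

open TensorProduct

variable {R : Type u} [CommRing R]

theorem extVanishes_congr_right (X : ModuleCat.{u} R) {Y Z : ModuleCat.{u} R} (e : Y ≃ₗ[R] Z)
    {j : ℕ} (h : extVanishes R X Y j) : extVanishes R X Z j := by
  unfold extVanishes at h ⊢
  exact (((Ext R (ModuleCat.{u} R) j).obj (Opposite.op X)).mapIso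
    e.toModuleIso).toLinearEquiv.symm.toEquiv.subsingleton

variable {C F : Type u} [AddCommGroup C] [Module R C] [AddCommGroup F] [Module R F]

theorem extVanishes_tensor [IsNoetherianRing R] [Module.Finite R C] [Module.Flat R F]
    {N : Type u} [AddCommGroup N] [Module R N] {j : ℕ} (hj : 0 < j)
    (h : extVanishes R (ModuleCat.of R C) (ModuleCat.of R N) j) :
    extVanishes R (ModuleCat.of R C) (ModuleCat.of R (N ⊗[R] F)) j := by
  obtain ⟨n, rfl⟩ := Nat.exists_eq_add_one_of_ne_zero hj.ne'
  obtain ⟨P, hP⟩ := exists_projectiveResolution_finite (R := R) C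
  have hproj (n : ℕ) : Module.Projective R (P.complex.X n) :=
    (IsProjective.iff_projective (P.complex.X n)).2 (P.projective n)
  rw [extVanishes_succ_iff P] at h ⊢
  exact exact_lcomp_tensor h

/-- If `R → Hom(C, C)` is bijective and `C` is finitely presented, then `F → Hom(C, C ⊗ F)` is
bijective for every flat module `F`. -/
theorem etaMap_bijective_of_flat [Module.FinitePresentation R C] [Module.Flat R F]
    (h : Function.Bijective (fun r : R => r • (LinearMap.id : C →ₗ[R] C))) :
    Function.Bijective (etaMap R C F) := by
  let χ : R ≃ₗ[R] (C →ₗ[R] C) :=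
    LinearEquiv.ofBijective (LinearMap.toSpanSingleton R (C →ₗ[R] C) LinearMap.id) h
  have heq : etaMap R C F = rTensorHomToHomRTensor (.id R) C C F ∘ₗ
      ((TensorProduct.lid R F).symm ≪≫ₗ χ.rTensor F).toLinearMap := by
    have hχ : χ 1 = LinearMap.id := one_smul R LinearMap.id
    ext x c
    simp [etaMap, hχ]
  rw [heq, LinearMap.coe_comp]
  exact rTensorHomToHomRTensor_bijective.comp (LinearEquiv.bijective _)

end Semidualizing

/-- An `R`-module `V` belongs to `F_C` if and only if `V` belongs to the Bass class `B_C`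
and `Hom_R(C,V)` is a flat `R`-module. -/
theorem mem_FC_iff
    (R : Type u) [CommRing R] [IsNoetherianRing R]
    (C : Type u) [AddCommGroup C] [Module R C] (hC : IsSemidualizing R C)
    (V : ModuleCat.{u} R) :
    memFC R C V ↔ memBass R C V ∧ Module.Flat R (C →ₗ[R] V) := by
  obtain ⟨hfin, hExt, hχ⟩ := hC
  constructor
  · rintro ⟨F, hF, ⟨e⟩⟩
    have := Module.finitePresentation_of_finite R C
    let θ : F ≃ₗ[R] (C →ₗ[R] V) :=
      LinearEquiv.ofBijective (etaMap R C F) (etaMap_bijective_of_flat hχ) ≪≫ₗ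
        e.symm.congrRight
    have hflat : Module.Flat R (C →ₗ[R] V) := Module.Flat.of_linearEquiv θ.symm
    refine ⟨⟨fun j hj => ?_, fun j hj => ?_, ?_⟩, hflat⟩
    · exact extVanishes_congr_right (Y := ModuleCat.of R (TensorProduct R C F)) _ e.symm
        (extVanishes_tensor hj (hExt j hj))
    · have : Module.Flat R (ModuleCat.of R (C →ₗ[R] V)) := hflat
      exact torVanishes_of_flat _ _ hj
    · have heq : epsMap R C V ∘ₗ (θ.lTensor C).toLinearMap = e.symm.toLinearMap := by
        ext c x
        simp [epsMap, θ, etaMap]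
        rfl
      rw [← Function.Bijective.of_comp_iff _ (θ.lTensor C).bijective]
      exact (congrArg (fun f : TensorProduct R C F →ₗ[R] V => Function.Bijective f) heq).mpr
        e.symm.bijective
  · rintro ⟨⟨-, -, hε⟩, hflat⟩
    exact ⟨ModuleCat.of R (C →ₗ[R] V), hflat, ⟨(LinearEquiv.ofBijective _ hε).symm⟩⟩
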